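/- Assume n ≥ 2, ‖z̄ − h̄‖₂ ≤ δ√n for some δ ∈ [0,1], and λ < 1/(4k). Then (TRS) has a unique global minimizer ĝ, and it satisfies (1/n)⟨h̄, ĝ⟩ ≥ 1 − 3δ/2 − λπ²M²(2k)^{2α+1}/n^{2α}. -/

import Mathlib

open scoped BigOperators
noncomputable section

namespace ModOne

/-- Grid points `x_i = (i-1)/(n-1)`, with `i : Fin n` zero-indexed. -/
def gridPt (n : ℕ) (i : Fin n) : ℝ := (i : ℝ) / ((n : ℝ) - 1)

/-- Adjacency of the path-power graph: `i ≠ j` and `|i − j| ≤ k`. -/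
def adj (n k : ℕ) (i j : Fin n) : Prop := i ≠ j ∧ |(i : ℤ) - (j : ℤ)| ≤ (k : ℤ)

instance adjDec (n k : ℕ) (i : Fin n) : DecidablePred (adj n k i) := fun j =>
  inferInstanceAs (Decidable (i ≠ j ∧ |(i : ℤ) - (j : ℤ)| ≤ (k : ℤ)))

/-- Degree of vertex `i` in the graph `G`. -/
def deg (n k : ℕ) (i : Fin n) : ℕ := (Finset.univ.filter (adj n k i)).card

/-- The graph Laplacian `L` of `G`. -/
def lap (n k : ℕ) : Matrix (Fin n) (Fin n) ℝ := fun i j =>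
  if i = j then (deg n k i : ℝ) else if adj n k i j then -1 else 0

/-- The block-diagonal matrix `H` with both diagonal blocks equal to `λL`. -/
def Hmat (n k : ℕ) (lam : ℝ) : Matrix (Fin n ⊕ Fin n) (Fin n ⊕ Fin n) ℝ :=
  Matrix.fromBlocks (lam • lap n k) 0 0 (lam • lap n k)

/-- The angular embedding `circ t = exp(2πι t)`. -/
def circ (t : ℝ) : ℂ := Complex.exp (2 * Real.pi * Complex.I * (t : ℂ))

/-- Real representation `(Re v, Im v) ∈ ℝ^{2n}` of a complex vector `v ∈ ℂ^n`. -/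
def embed (n : ℕ) (v : Fin n → ℂ) : Fin n ⊕ Fin n → ℝ :=
  Sum.elim (fun i => (v i).re) (fun i => (v i).im)

/-- Real representation of the angular embedding of a vector of values `t : Fin n → ℝ`. -/
def cvec (n : ℕ) (t : Fin n → ℝ) : Fin n ⊕ Fin n → ℝ := embed n (fun i => circ (t i))

/-- Quadratic form `vᵀ A v`. -/
def quad (n : ℕ) (A : Matrix (Fin n ⊕ Fin n) (Fin n ⊕ Fin n) ℝ) (v : Fin n ⊕ Fin n → ℝ) : ℝ :=
  ∑ i, v i * A.mulVec v i

/-- Euclidean inner product on `ℝ^{2n}`. -/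
def dotR (n : ℕ) (u v : Fin n ⊕ Fin n → ℝ) : ℝ := ∑ i, u i * v i

/-- Euclidean norm on `ℝ^{2n}`. -/
def norm2 (n : ℕ) (v : Fin n ⊕ Fin n → ℝ) : ℝ := Real.sqrt (∑ i, (v i) ^ 2)

/-- Feasibility for (TRS): `‖g‖₂² = n`. -/
def feasible (n : ℕ) (g : Fin n ⊕ Fin n → ℝ) : Prop := ∑ i, (g i) ^ 2 = (n : ℝ)

/-- The (TRS) objective `ḡᵀHḡ − 2ḡᵀz̄`. -/
def objective (n k : ℕ) (lam : ℝ) (zbar g : Fin n ⊕ Fin n → ℝ) : ℝ :=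
  quad n (Hmat n k lam) g - 2 * dotR n g zbar

/-- `g` is a global minimizer of (TRS) with data `z̄`. -/
def minimizer (n k : ℕ) (lam : ℝ) (zbar g : Fin n ⊕ Fin n → ℝ) : Prop :=
  feasible n g ∧ ∀ g', feasible n g' → objective n k lam zbar g ≤ objective n k lam zbar g'

/-- `z̄` is orthogonal to the null space `N(H)` of `H`. -/
def perpNull (n k : ℕ) (lam : ℝ) (z : Fin n ⊕ Fin n → ℝ) : Prop :=
  ∀ v, (Hmat n k lam).mulVec v = 0 → dotR n z v = 0

end ModOne

open Matrix

/-- Minimizing `vᵀAv - 2vᵀz` over the sphere of radius `‖z‖` is well posed for `0 ≤ A ≤ 1`. -/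
theorem existsUnique_trustRegion_minimizer {ι : Type*} [Fintype ι] {A : Matrix ι ι ℝ}
    (hA : A.IsSymm) (h0 : ∀ v : ι → ℝ, 0 ≤ v ⬝ᵥ A *ᵥ v) (h1 : ∀ v : ι → ℝ, v ⬝ᵥ A *ᵥ v ≤ v ⬝ᵥ v)
    (z : ι → ℝ) :
    ∃ g, (g ⬝ᵥ g = z ⬝ᵥ z ∧ ∀ g', g' ⬝ᵥ g' = z ⬝ᵥ z →
        g ⬝ᵥ A *ᵥ g - 2 * (g ⬝ᵥ z) ≤ g' ⬝ᵥ A *ᵥ g' - 2 * (g' ⬝ᵥ z)) ∧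
      ∀ g₂, (g₂ ⬝ᵥ g₂ = z ⬝ᵥ z ∧ ∀ g', g' ⬝ᵥ g' = z ⬝ᵥ z →
        g₂ ⬝ᵥ A *ᵥ g₂ - 2 * (g₂ ⬝ᵥ z) ≤ g' ⬝ᵥ A *ᵥ g' - 2 * (g' ⬝ᵥ z)) → g₂ = g := by
  set F : (ι → ℝ) → ℝ := fun v => v ⬝ᵥ A *ᵥ v - 2 * (v ⬝ᵥ z) with hF
  have hsymm (u v : ι → ℝ) : u ⬝ᵥ A *ᵥ v = v ⬝ᵥ A *ᵥ u := by
    rw [dotProduct_mulVec, ← mulVec_transpose, hA.eq, dotProduct_comm]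
  have hnn (v : ι → ℝ) : 0 ≤ v ⬝ᵥ v := Finset.sum_nonneg fun i _ => mul_self_nonneg (v i)
  set B : Set (ι → ℝ) := {v | v ⬝ᵥ v ≤ z ⬝ᵥ z} with hB
  have hcompact : IsCompact B := by
    refine Metric.isCompact_of_isClosed_isBounded
      (isClosed_le (by unfold dotProduct; fun_prop) continuous_const) ?_
    refine (Metric.isBounded_closedBall (x := (0 : ι → ℝ)) (r := √(z ⬝ᵥ z))).subset ?_
    intro v hv
    rw [mem_closedBall_zero_iff, pi_norm_le_iff_of_nonneg (Real.sqrt_nonneg _)]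
    intro i
    refine Real.abs_le_sqrt (le_trans ?_ hv)
    rw [sq]
    exact Finset.single_le_sum (f := fun i => v i * v i) (fun i _ => mul_self_nonneg (v i))
      (Finset.mem_univ i)
  have hcont : Continuous F := by
    simp only [hF, dotProduct, mulVec]
    fun_prop
  have hexp (m d : ι → ℝ) (t : ℝ) : F (m + t • d) =
      F m + 2 * t * (d ⬝ᵥ (A *ᵥ m - z)) + t ^ 2 * (d ⬝ᵥ A *ᵥ d) := by
    simp only [hF, mulVec_add, mulVec_smul, dotProduct_add, add_dotProduct, smul_dotProduct,
      dotProduct_smul, dotProduct_sub, smul_eq_mul, hsymm m d]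
    ring
  have hbdry (m : ι → ℝ) (hm : m ∈ B) (hmin : ∀ v ∈ B, F m ≤ F v) : m ⬝ᵥ m = z ⬝ᵥ z := by
    by_contra hne
    have hlt : m ⬝ᵥ m < z ⬝ᵥ z := lt_of_le_of_ne hm hne
    set d := z - A *ᵥ m with hd
    have hdpos : 0 < d ⬝ᵥ d := by
      refine lt_of_le_of_ne (hnn d) fun h => ?_
      have hz : z = A *ᵥ m := sub_eq_zero.mp (dotProduct_self_eq_zero.mp h.symm)
      have hzz : z ⬝ᵥ z = z ⬝ᵥ A *ᵥ m := by rw [← hz]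
      have hpsd := h0 (z - m)
      simp only [mulVec_sub, dotProduct_sub, sub_dotProduct, hsymm m z] at hpsd
      linarith [h1 z, h1 m]
    have hnear : ∀ᶠ t in nhdsWithin (0 : ℝ) (Set.Ioi 0),
        (m + t • d) ⬝ᵥ (m + t • d) < z ⬝ᵥ z := by
      refine Filter.Eventually.filter_mono nhdsWithin_le_nhds ?_
      have hc : Continuous fun t : ℝ => (m + t • d) ⬝ᵥ (m + t • d) := by
        unfold dotProduct
        fun_prop
      exact (hc.tendsto 0).eventually_lt_const (by simpa using hlt)
    obtain ⟨t, ht, ht0, ht1⟩ :=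
      (hnear.and (Ioo_mem_nhdsGT (zero_lt_one' ℝ))).exists
    have h := hmin _ (show m + t • d ∈ B from ht.le)
    have hneg : A *ᵥ m - z = -d := by rw [hd, neg_sub]
    rw [hexp, hneg, dotProduct_neg] at h
    nlinarith [mul_le_mul_of_nonneg_left (h1 d) (sq_nonneg t),
      mul_pos (mul_pos ht0 (sub_pos.mpr ht1)) hdpos, mul_pos ht0 hdpos]
  obtain ⟨g, hgB, hg⟩ := hcompact.exists_isMinOn ⟨z, le_refl (z ⬝ᵥ z)⟩ hcont.continuousOn
  have hgmin : ∀ v ∈ B, F g ≤ F v := fun v hv => hg hv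
  have hgz := hbdry g hgB hgmin
  refine ⟨g, ⟨hgz, fun g' h' => hgmin g' h'.le⟩, fun g₂ ⟨hz₂, hmin₂⟩ => ?_⟩
  have hle : F g₂ ≤ F g := hmin₂ g hgz
  set d := g₂ - g with hd
  have hg₂ : g₂ = g + (1 : ℝ) • d := by rw [one_smul, hd, add_sub_cancel]
  have hF₂ := hexp g d 1
  rw [← hg₂] at hF₂
  have hFm := hexp g d (1 / 2)
  have hdd : 2 * (g ⬝ᵥ d) + d ⬝ᵥ d = 0 := by
    have h := hz₂
    rw [hg₂] at h
    simp only [one_smul, dotProduct_add, add_dotProduct, dotProduct_comm d g] at h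
    linarith
  have hmm : (g + (1 / 2 : ℝ) • d) ⬝ᵥ (g + (1 / 2 : ℝ) • d) = z ⬝ᵥ z - d ⬝ᵥ d / 4 := by
    simp only [dotProduct_add, add_dotProduct, smul_dotProduct, dotProduct_smul, smul_eq_mul,
      dotProduct_comm d g]
    linarith
  have hmB : g + (1 / 2 : ℝ) • d ∈ B := by
    rw [hB, Set.mem_ofPred_eq]
    linarith [hnn d]
  have hz := hbdry _ hmB fun v hv => by linarith [hgmin v hv, h0 d]
  have hd0 : d = 0 := dotProduct_self_eq_zero.mp (by linarith)
  exact sub_eq_zero.mp hd0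

namespace ModOne

theorem adj_comm (n k : ℕ) (i j : Fin n) : adj n k i j ↔ adj n k j i := by
  unfold adj
  rw [ne_comm, abs_sub_comm]

theorem deg_le (n k : ℕ) (i : Fin n) : deg n k i ≤ 2 * k := by
  have hmem : (i : ℤ) ∈ Finset.Icc ((i : ℤ) - k) (i + k) := by simp
  have hcard : ((Finset.Icc ((i : ℤ) - k) (i + k)).erase (i : ℤ)).card = 2 * k := by
    rw [Finset.card_erase_of_mem hmem, Int.card_Icc]
    omega
  rw [← hcard]
  refine Finset.card_le_card_of_injOn (fun j : Fin n => (j : ℤ)) ?_ ?_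
  · intro j hj
    obtain ⟨hne, hle⟩ := (Finset.mem_filter.mp hj).2
    rw [abs_le] at hle
    simp only [Finset.coe_erase, Finset.coe_Icc, Set.mem_sdiff, Set.mem_Icc,
      Set.mem_singleton_iff]
    exact ⟨by omega, fun h => hne (Fin.ext (by exact_mod_cast h.symm))⟩
  · exact fun a _ b _ h => Fin.ext (Int.ofNat_inj.mp h)

theorem sum_adj_const (n k : ℕ) (i : Fin n) (c : ℝ) :
    ∑ j, (if adj n k i j then c else 0) = deg n k i * c := by
  rw [← Finset.sum_filter, Finset.sum_const, nsmul_eq_mul, deg]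

theorem lap_mulVec (n k : ℕ) (w : Fin n → ℝ) (i : Fin n) :
    (lap n k *ᵥ w) i = ∑ j, if adj n k i j then w i - w j else 0 := by
  have hterm (j : Fin n) : lap n k i j * w j =
      (if i = j then (deg n k i : ℝ) * w j else 0) - (if adj n k i j then w j else 0) := by
    unfold lap
    by_cases hij : i = j
    · simp [hij, adj]
    · by_cases h : adj n k i j <;> simp [hij, h]
  have hsplit (j : Fin n) : (if adj n k i j then w i - w j else 0) =
      (if adj n k i j then w i else 0) - (if adj n k i j then w j else 0) := by
    split_ifs <;> simp
  simp only [mulVec, dotProduct, hterm, hsplit, Finset.sum_sub_distrib, sum_adj_const,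
    Finset.sum_ite_eq, Finset.mem_univ, if_true]

theorem dotProduct_lap_mulVec (n k : ℕ) (w : Fin n → ℝ) :
    w ⬝ᵥ lap n k *ᵥ w = (∑ i, ∑ j, if adj n k i j then (w i - w j) ^ 2 else 0) / 2 := by
  have h₁ : w ⬝ᵥ lap n k *ᵥ w = ∑ i, ∑ j, if adj n k i j then w i * (w i - w j) else 0 := by
    simp only [dotProduct, lap_mulVec, Finset.mul_sum, mul_ite, mul_zero]
  have h₂ : w ⬝ᵥ lap n k *ᵥ w = ∑ i, ∑ j, if adj n k i j then w j * (w j - w i) else 0 := by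
    rw [h₁, Finset.sum_comm]
    refine Finset.sum_congr rfl fun i _ => Finset.sum_congr rfl fun j _ => ?_
    simp only [adj_comm n k j i]
  have h₃ : w ⬝ᵥ lap n k *ᵥ w + w ⬝ᵥ lap n k *ᵥ w =
      ∑ i, ∑ j, if adj n k i j then (w i - w j) ^ 2 else 0 := by
    nth_rewrite 1 [h₁]
    rw [h₂]
    simp only [← Finset.sum_add_distrib]
    refine Finset.sum_congr rfl fun i _ => Finset.sum_congr rfl fun j _ => ?_
    split_ifs <;> ring
  linarith

theorem dotProduct_lap_mulVec_nonneg (n k : ℕ) (w : Fin n → ℝ) : 0 ≤ w ⬝ᵥ lap n k *ᵥ w := by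
  rw [dotProduct_lap_mulVec]
  refine div_nonneg (Finset.sum_nonneg fun i _ => Finset.sum_nonneg fun j _ => ?_) zero_le_two
  split_ifs <;> positivity

theorem dotProduct_lap_mulVec_le (n k : ℕ) (w : Fin n → ℝ) :
    w ⬝ᵥ lap n k *ᵥ w ≤ 4 * k * (w ⬝ᵥ w) := by
  have hrow : ∑ i, ∑ j, (if adj n k i j then w i ^ 2 else 0) ≤ 2 * k * (w ⬝ᵥ w) := by
    simp only [sum_adj_const, dotProduct, Finset.mul_sum]
    refine Finset.sum_le_sum fun i _ => ?_
    have hdeg : (deg n k i : ℝ) ≤ 2 * k := by exact_mod_cast deg_le n k i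
    nlinarith [sq_nonneg (w i)]
  have hcol : ∑ i, ∑ j, (if adj n k i j then w j ^ 2 else 0) =
      ∑ i, ∑ j, (if adj n k i j then w i ^ 2 else 0) := by
    rw [Finset.sum_comm]
    refine Finset.sum_congr rfl fun i _ => Finset.sum_congr rfl fun j _ => ?_
    simp only [adj_comm n k j i]
  have hle : ∑ i, ∑ j, (if adj n k i j then (w i - w j) ^ 2 else 0) ≤
      2 * ∑ i, ∑ j, (if adj n k i j then w i ^ 2 else 0) +
        2 * ∑ i, ∑ j, (if adj n k i j then w j ^ 2 else 0) := by
    simp only [Finset.mul_sum, ← Finset.sum_add_distrib]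
    refine Finset.sum_le_sum fun i _ => Finset.sum_le_sum fun j _ => ?_
    split_ifs
    · nlinarith [sq_nonneg (w i + w j)]
    · simp
  rw [dotProduct_lap_mulVec]
  linarith

theorem lap_isSymm (n k : ℕ) : (lap n k).IsSymm := by
  ext i j
  by_cases h : i = j
  · rw [h, Matrix.transpose_apply]
  · simp only [Matrix.transpose_apply, lap, h, Ne.symm h, if_false, adj_comm n k j i]

theorem Hmat_isSymm (n k : ℕ) (lam : ℝ) : (Hmat n k lam).IsSymm :=
  Matrix.IsSymm.fromBlocks ((lap_isSymm n k).smul lam) (by simp) ((lap_isSymm n k).smul lam)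

theorem dotProduct_Hmat_mulVec (n k : ℕ) (lam : ℝ) (v : Fin n ⊕ Fin n → ℝ) :
    v ⬝ᵥ Hmat n k lam *ᵥ v = lam * ((v ∘ Sum.inl) ⬝ᵥ lap n k *ᵥ (v ∘ Sum.inl) +
      (v ∘ Sum.inr) ⬝ᵥ lap n k *ᵥ (v ∘ Sum.inr)) := by
  rw [Hmat, fromBlocks_mulVec]
  simp only [zero_mulVec, add_zero, zero_add, smul_mulVec, dotProduct, Fintype.sum_sum_type,
    Sum.elim_inl, Sum.elim_inr, Pi.smul_apply, smul_eq_mul, Function.comp_apply, mul_add,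
    Finset.mul_sum]
  congr 1 <;> exact Finset.sum_congr rfl fun i _ => by ring

theorem norm_circ (a : ℝ) : ‖circ a‖ = 1 := by
  have h : circ a = Complex.exp (Complex.I * ((2 * Real.pi * a : ℝ) : ℂ)) := by
    rw [circ]
    congr 1
    push_cast
    ring
  rw [h, Complex.norm_exp_I_mul_ofReal]

theorem norm_circ_sub_le (a b : ℝ) : ‖circ a - circ b‖ ≤ 2 * Real.pi * |a - b| := by
  have h : circ a - circ b =
      circ b * (Complex.exp (Complex.I * ((2 * Real.pi * (a - b) : ℝ) : ℂ)) - 1) := by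
    rw [mul_sub, circ, circ, ← Complex.exp_add, mul_one]
    congr 2
    push_cast
    ring
  rw [h, norm_mul, norm_circ, one_mul]
  refine (Real.norm_exp_I_mul_ofReal_sub_one_le).trans_eq ?_
  rw [Real.norm_eq_abs, abs_mul, abs_of_pos Real.two_pi_pos]

theorem cvec_dotProduct_self (n : ℕ) (t : Fin n → ℝ) : cvec n t ⬝ᵥ cvec n t = n := by
  have h (i : Fin n) :
      (circ (t i)).re * (circ (t i)).re + (circ (t i)).im * (circ (t i)).im = 1 := by
    rw [← Complex.normSq_apply, Complex.normSq_eq_norm_sq, norm_circ, one_pow]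
  simp only [cvec, embed, dotProduct, Fintype.sum_sum_type, Sum.elim_inl, Sum.elim_inr,
    ← Finset.sum_add_distrib, h]
  simp

/-- If neighbouring samples differ by at most `c`, the Laplacian energy of their angular
embedding is at most `4π²c²` times the number of edges. -/
theorem cvec_Hmat_le (n k : ℕ) {lam c : ℝ} (hlam : 0 ≤ lam) (t : Fin n → ℝ)
    (ht : ∀ i j, adj n k i j → |t i - t j| ≤ c) :
    cvec n t ⬝ᵥ Hmat n k lam *ᵥ cvec n t ≤ lam * (n * k * (2 * Real.pi * c) ^ 2) := by
  rw [dotProduct_Hmat_mulVec, dotProduct_lap_mulVec, dotProduct_lap_mulVec, ← add_div,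
    ← Finset.sum_add_distrib]
  simp only [← Finset.sum_add_distrib]
  refine mul_le_mul_of_nonneg_left ?_ hlam
  have hedge (i j : Fin n) :
      (if adj n k i j then ((cvec n t ∘ Sum.inl) i - (cvec n t ∘ Sum.inl) j) ^ 2 else 0) +
        (if adj n k i j then ((cvec n t ∘ Sum.inr) i - (cvec n t ∘ Sum.inr) j) ^ 2 else 0) ≤
      if adj n k i j then (2 * Real.pi * c) ^ 2 else 0 := by
    split_ifs with h
    · have heq : ((cvec n t ∘ Sum.inl) i - (cvec n t ∘ Sum.inl) j) ^ 2 +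
          ((cvec n t ∘ Sum.inr) i - (cvec n t ∘ Sum.inr) j) ^ 2 =
          ‖circ (t i) - circ (t j)‖ ^ 2 := by
        rw [← Complex.normSq_eq_norm_sq, Complex.normSq_apply]
        simp only [cvec, embed, Function.comp_apply, Sum.elim_inl, Sum.elim_inr, Complex.sub_re,
          Complex.sub_im]
        ring
      rw [heq]
      refine pow_le_pow_left₀ (norm_nonneg _) ((norm_circ_sub_le _ _).trans ?_) 2
      exact mul_le_mul_of_nonneg_left (ht i j h) Real.two_pi_pos.le
    · simp
  have hrow (i : Fin n) : (deg n k i : ℝ) * (2 * Real.pi * c) ^ 2 ≤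
      2 * k * (2 * Real.pi * c) ^ 2 :=
    mul_le_mul_of_nonneg_right (by exact_mod_cast deg_le n k i) (sq_nonneg _)
  have hsum := Finset.sum_le_sum fun i (_ : i ∈ Finset.univ) =>
    (Finset.sum_le_sum fun j (_ : j ∈ Finset.univ) => hedge i j).trans
      ((sum_adj_const n k i _).trans_le (hrow i))
  refine (div_le_div_of_nonneg_right hsum zero_le_two).trans_eq ?_
  rw [Finset.sum_const, Finset.card_univ, Fintype.card_fin, nsmul_eq_mul]
  ring

theorem gridPt_mem_Icc {n : ℕ} (hn : 2 ≤ n) (i : Fin n) : gridPt n i ∈ Set.Icc (0 : ℝ) 1 := by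
  have hn' : (2 : ℝ) ≤ n := by exact_mod_cast hn
  have hi : ((i : ℕ) : ℝ) + 1 ≤ n := by exact_mod_cast i.isLt
  refine ⟨div_nonneg (Nat.cast_nonneg _) (by linarith), ?_⟩
  rw [gridPt, div_le_one (by linarith)]
  linarith

theorem abs_gridPt_sub_le {n k : ℕ} (hn : 2 ≤ n) {i j : Fin n} (h : adj n k i j) :
    |gridPt n i - gridPt n j| ≤ 2 * k / n := by
  have hn' : (2 : ℝ) ≤ n := by exact_mod_cast hn
  have hk : |((i : ℕ) : ℝ) - ((j : ℕ) : ℝ)| ≤ k := by exact_mod_cast h.2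
  have hk0 : (0 : ℝ) ≤ k := Nat.cast_nonneg k
  rw [gridPt, gridPt, ← sub_div, abs_div, abs_of_pos (by linarith : (0 : ℝ) < n - 1),
    div_le_div_iff₀ (by linarith) (by linarith)]
  nlinarith [mul_le_mul_of_nonneg_right hk (by linarith : (0 : ℝ) ≤ n)]

end ModOne

open ModOne in
/-- Assume `n ≥ 2`, `‖z̄ − h̄‖₂ ≤ δ√n` for some `δ ∈ [0,1]`, and `λ < 1/(4k)`.
Then (TRS) has a unique global minimizer `ĝ`, and it satisfies
`(1/n)⟨h̄, ĝ⟩ ≥ 1 − 3δ/2 − λπ²M²(2k)^{2α+1}/n^{2α}`. -/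
theorem statement8 (n k : ℕ) (hn : 2 ≤ n) (hk₁ : 1 ≤ k) (hk₂ : k ≤ n - 1)
    (lam : ℝ) (hlam : 0 ≤ lam) (hlam' : lam < 1 / (4 * (k:ℝ)))
    (f : ℝ → ℝ) (M α : ℝ) (hM : 0 < M) (hα : α ∈ Set.Ioc (0:ℝ) 1)
    (hf : ∀ x ∈ Set.Icc (0:ℝ) 1, ∀ y ∈ Set.Icc (0:ℝ) 1, |f x - f y| ≤ M * |x - y| ^ α)
    (y : Fin n → ℝ) (hy : ∀ i, y i ∈ Set.Ico (0:ℝ) 1)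
    (δ : ℝ) (hδ : δ ∈ Set.Icc (0:ℝ) 1)
    (hnoise : norm2 n (cvec n y - cvec n (fun i => f (gridPt n i))) ≤ δ * Real.sqrt n) :
    ∃ g, minimizer n k lam (cvec n y) g ∧
      (∀ g', minimizer n k lam (cvec n y) g' → g' = g) ∧
      (1 / (n:ℝ)) * dotR n (cvec n (fun i => f (gridPt n i))) g ≥
        1 - 3 * δ / 2
          - lam * Real.pi ^ 2 * M ^ 2 * (2 * (k:ℝ)) ^ (2 * α + 1) / (n:ℝ) ^ (2 * α) := by
  have hn0 : (0 : ℝ) < n := by exact_mod_cast (by omega : 0 < n)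
  have hk0 : (0 : ℝ) < k := by exact_mod_cast hk₁
  have hlamk : lam * (4 * k) ≤ 1 := ((lt_div_iff₀ (by positivity)).mp hlam').le
  set z := cvec n y with hzdef
  set h := cvec n (fun i => f (gridPt n i)) with hhdef
  set A := Hmat n k lam with hAdef
  have hzz : z ⬝ᵥ z = n := cvec_dotProduct_self n y
  have hhh : h ⬝ᵥ h = n := cvec_dotProduct_self n _
  have hsq (v : Fin n ⊕ Fin n → ℝ) : v ⬝ᵥ v = ∑ i, v i ^ 2 :=
    Finset.sum_congr rfl fun i _ => (sq (v i)).symm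
  have hmin (g : Fin n ⊕ Fin n → ℝ) : minimizer n k lam z g ↔
      (g ⬝ᵥ g = z ⬝ᵥ z ∧ ∀ g', g' ⬝ᵥ g' = z ⬝ᵥ z →
        g ⬝ᵥ A *ᵥ g - 2 * (g ⬝ᵥ z) ≤ g' ⬝ᵥ A *ᵥ g' - 2 * (g' ⬝ᵥ z)) := by
    simp only [hzz, hsq]
    rfl
  have hA0 (v : Fin n ⊕ Fin n → ℝ) : 0 ≤ v ⬝ᵥ A *ᵥ v := by
    rw [dotProduct_Hmat_mulVec]
    exact mul_nonneg hlam (add_nonneg (dotProduct_lap_mulVec_nonneg n k _)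
      (dotProduct_lap_mulVec_nonneg n k _))
  have hA1 (v : Fin n ⊕ Fin n → ℝ) : v ⬝ᵥ A *ᵥ v ≤ v ⬝ᵥ v := by
    have hsplit : v ⬝ᵥ v = (v ∘ Sum.inl) ⬝ᵥ (v ∘ Sum.inl) + (v ∘ Sum.inr) ⬝ᵥ (v ∘ Sum.inr) :=
      Fintype.sum_sum_type _
    have hvv : 0 ≤ v ⬝ᵥ v := Finset.sum_nonneg fun i _ => mul_self_nonneg (v i)
    have hL := mul_le_mul_of_nonneg_left (add_le_add
      (dotProduct_lap_mulVec_le n k (v ∘ Sum.inl)) (dotProduct_lap_mulVec_le n k (v ∘ Sum.inr))) hlam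
    rw [← mul_add, ← hsplit] at hL
    rw [dotProduct_Hmat_mulVec]
    nlinarith [mul_le_mul_of_nonneg_right hlamk hvv]
  obtain ⟨g, hg, huniq⟩ :=
    existsUnique_trustRegion_minimizer (Hmat_isSymm n k lam) hA0 hA1 z
  refine ⟨g, (hmin g).mpr hg, fun g' hg' => huniq g' ((hmin g').mp hg'), ?_⟩
  have hgg : g ⬝ᵥ g = n := hg.1.trans hzz
  have hcmp := hg.2 h (hhh.trans hzz.symm)
  have hnoise' : (z - h) ⬝ᵥ (z - h) ≤ δ ^ 2 * n := by
    rw [hsq]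
    have := (Real.sqrt_le_left (mul_nonneg hδ.1 (Real.sqrt_nonneg _))).mp hnoise
    rwa [mul_pow, Real.sq_sqrt hn0.le] at this
  have hhz : n * (1 - δ ^ 2 / 2) ≤ h ⬝ᵥ z := by
    have hexp := hnoise'
    simp only [dotProduct_sub, sub_dotProduct, hzz, hhh, dotProduct_comm z h] at hexp
    linarith
  have hgzh : g ⬝ᵥ (z - h) ≤ δ * n := by
    refine (Real.sum_mul_le_sqrt_mul_sqrt Finset.univ g (z - h)).trans ?_
    rw [← hsq, hgg]
    refine (mul_le_mul_of_nonneg_left hnoise (Real.sqrt_nonneg _)).trans_eq ?_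
    rw [mul_left_comm, Real.mul_self_sqrt hn0.le]
  rw [dotProduct_sub] at hgzh
  have hAh := cvec_Hmat_le n k hlam (fun i => f (gridPt n i)) (c := M * (2 * k / n) ^ α)
    fun i j hij => (hf _ (gridPt_mem_Icc hn i) _ (gridPt_mem_Icc hn j)).trans
      (mul_le_mul_of_nonneg_left
        (Real.rpow_le_rpow (abs_nonneg _) (abs_gridPt_sub_le hn hij) hα.1.le) hM.le)
  have hpow : (((2 * k / n : ℝ)) ^ α) ^ 2 = (2 * k) ^ (2 * α) / n ^ (2 * α) := by
    rw [← Real.div_rpow (by positivity) hn0.le, mul_comm 2 α, Real.rpow_mul (by positivity),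
      Real.rpow_two]
  have hbias : lam * (n * k * (2 * Real.pi * (M * (2 * k / n) ^ α)) ^ 2) =
      2 * n * (lam * Real.pi ^ 2 * M ^ 2 * (2 * (k : ℝ)) ^ (2 * α + 1) / (n : ℝ) ^ (2 * α)) := by
    rw [mul_pow, mul_pow M, hpow, Real.rpow_add (by positivity), Real.rpow_one]
    ring
  rw [hbias] at hAh
  have hδ2 : n * δ ^ 2 ≤ n * δ :=
    mul_le_mul_of_nonneg_left (by nlinarith [hδ.1, hδ.2]) hn0.le
  have hdot : dotR n h g = g ⬝ᵥ h := dotProduct_comm h g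
  rw [hdot, ge_iff_le, one_div, inv_mul_eq_div, le_div_iff₀ hn0]
  linarith [hA0 g]
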